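/- arXiv:0802.4270 — 3 statements merged into one kernel-verified Lean document; each statement's English description precedes it below -/
import Mathlib

section
/- If an additive subgroup C ≤ F_q^{2n} defines a subsystem code with parameters ((n,K,R,d))_q where K > 1, then there exists an additive subgroup C' ≤ F_q^{2(n+1)} defining a subsystem code with parameters ((n+1, K, R, d'))_q with d' ≥ d that is pure to 1. -/
open Matrix
open scoped Classical

/-- The symplectic vector space `F_q^{2n}`: pairs `(x|y)` with `x, y ∈ F_q^n`. -/
abbrev SV (F : Type*) (n : ℕ) := (Fin n → F) × (Fin n → F)

/-- The symplectic weight `swt(x|y) = #{i : (x_i, y_i) ≠ (0,0)}`. -/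
noncomputable def swt {F : Type*} [Zero F] {n : ℕ} (v : SV F n) : ℕ :=
  Nat.card {i : Fin n // v.1 i ≠ 0 ∨ v.2 i ≠ 0}

/-- minimum symplectic weight of a nonzero element of a set -/
noncomputable def swtSet {F : Type*} [Zero F] {n : ℕ} (S : Set (SV F n)) : ℕ :=
  sInf (swt '' {v | v ∈ S ∧ v ≠ 0})

/-- The trace-symplectic form `⟨u|v⟩ₛ = Tr_{q/p}(v₁·u₂ − u₁·v₂)`. -/
noncomputable def trSymp (p : ℕ) {F : Type*} [Field F] [Fintype F] [CharP F p] {n : ℕ}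
    (u v : SV F n) : ZMod p :=
  letI := ZMod.algebra F p
  Algebra.trace (ZMod p) F (dotProduct v.1 u.2 - dotProduct u.1 v.2)

/-- The trace-symplectic dual of a subset of `F_q^{2n}`. -/
def sdual (p : ℕ) {F : Type*} [Field F] [Fintype F] [CharP F p] {n : ℕ}
    (S : Set (SV F n)) : Set (SV F n) :=
  {v | ∀ w ∈ S, trSymp p v w = 0}

/-- `C` defines a subsystem code with parameters `((n,K,R,d))_q`, where
`K = q^n/(|C||D|)^{1/2}`, `R = (|C|/|D|)^{1/2}` for `D = C ∩ C^⊥s`, and `d` is the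
symplectic weight of `D^⊥s \ C` (resp. of `D^⊥s` if `D^⊥s = C`). -/
def IsSubsystemCode (p : ℕ) {F : Type*} [Field F] [Fintype F] [CharP F p] {n : ℕ}
    (K R d : ℕ) (C : AddSubgroup (SV F n)) : Prop :=
  C ≠ ⊥ ∧
  K ^ 2 * (Nat.card C * Nat.card ↥((C : Set (SV F n)) ∩ sdual p (C : Set (SV F n)))) =
    Fintype.card F ^ (2 * n) ∧
  R ^ 2 * Nat.card ↥((C : Set (SV F n)) ∩ sdual p (C : Set (SV F n))) = Nat.card C ∧
  d = if sdual p ((C : Set (SV F n)) ∩ sdual p (C : Set (SV F n))) = (C : Set (SV F n))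
      then swtSet (sdual p ((C : Set (SV F n)) ∩ sdual p (C : Set (SV F n))))
      else swtSet (sdual p ((C : Set (SV F n)) ∩ sdual p (C : Set (SV F n))) \ (C : Set (SV F n)))

/-- The subsystem code defined by `C` is pure to `d'`, i.e. `swt(D^⊥s) ≥ d'`. -/
def PureTo (p : ℕ) {F : Type*} [Field F] [Fintype F] [CharP F p] {n : ℕ}
    (d' : ℕ) (C : AddSubgroup (SV F n)) : Prop :=
  d' ≤ swtSet (sdual p ((C : Set (SV F n)) ∩ sdual p (C : Set (SV F n))))

namespace SV

/-- The vectors of `F_q^{2(n+1)}` of the form `(α, x | 0, y)` with `(x|y) ∈ S`. -/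
def extend {F : Type*} [Zero F] {n : ℕ} (S : Set (SV F n)) : Set (SV F (n + 1)) :=
  {w | w.2 0 = 0 ∧ (Fin.tail w.1, Fin.tail w.2) ∈ S}

lemma extend_inter {F : Type*} [Zero F] {n : ℕ} (S T : Set (SV F n)) :
    extend (S ∩ T) = extend S ∩ extend T := by
  ext w
  simp only [extend, Set.mem_inter_iff, Set.mem_ofPred_eq]
  tauto

lemma extend_diff {F : Type*} [Zero F] {n : ℕ} (S T : Set (SV F n)) :
    extend (S \ T) = extend S \ extend T := by
  ext w
  simp only [extend, Set.mem_sdiff, Set.mem_ofPred_eq]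
  tauto

lemma cons_mem_extend {F : Type*} [Zero F] {n : ℕ} {S : Set (SV F n)} {v : SV F n} (hv : v ∈ S)
    (a : F) : ((Fin.cons a v.1, Fin.cons 0 v.2) : SV F (n + 1)) ∈ extend S :=
  ⟨rfl, by simpa using hv⟩

/-- `extend S` is parametrized by `F × S`. -/
def extendEquiv {F : Type*} [Zero F] {n : ℕ} (S : Set (SV F n)) : extend S ≃ F × S where
  toFun w := (w.1.1 0, ⟨_, w.2.2⟩)
  invFun z := ⟨_, cons_mem_extend z.2.2 z.1⟩
  left_inv := by
    rintro ⟨w, hw, hS⟩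
    refine Subtype.ext (Prod.ext ?_ ?_)
    · exact Fin.cons_self_tail w.1
    · change Fin.cons 0 (Fin.tail w.2) = w.2
      rw [← hw, Fin.cons_self_tail]
  right_inv := by
    rintro ⟨a, v, hv⟩
    rfl

lemma card_extend {F : Type*} [Zero F] [Fintype F] {n : ℕ} (S : Set (SV F n)) :
    Nat.card (extend S) = Fintype.card F * Nat.card S := by
  rw [Nat.card_congr (extendEquiv S), Nat.card_prod, Nat.card_eq_fintype_card]

/-- `extend C` as an additive subgroup. -/
def extendAddSubgroup {F : Type*} [AddCommGroup F] {n : ℕ} (C : AddSubgroup (SV F n)) :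
    AddSubgroup (SV F (n + 1)) where
  carrier := extend (C : Set (SV F n))
  zero_mem' := ⟨rfl, C.zero_mem⟩
  add_mem' := by
    rintro v w ⟨hv, hv'⟩ ⟨hw, hw'⟩
    exact ⟨by simp [hv, hw], C.add_mem hv' hw'⟩
  neg_mem' := by
    rintro v ⟨hv, hv'⟩
    exact ⟨by simp [hv], C.neg_mem hv'⟩

lemma coe_extendAddSubgroup {F : Type*} [AddCommGroup F] {n : ℕ} (C : AddSubgroup (SV F n)) :
    (extendAddSubgroup C : Set (SV F (n + 1))) = extend (C : Set (SV F n)) :=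
  rfl

end SV

lemma swt_tail_le {F : Type*} [Zero F] {n : ℕ} (w : SV F (n + 1)) :
    swt ((Fin.tail w.1, Fin.tail w.2) : SV F n) ≤ swt w :=
  Nat.card_le_card_of_injective
    (fun i => (⟨i.1.succ, i.2⟩ : {i : Fin (n + 1) // w.1 i ≠ 0 ∨ w.2 i ≠ 0}))
    fun _ _ hij => Subtype.ext (Fin.succ_injective _ (congrArg Subtype.val hij))

lemma swt_pos {F : Type*} [Zero F] {n : ℕ} {v : SV F n} (hv : v ≠ 0) : 0 < swt v := by
  rw [swt, Nat.card_pos_iff]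
  refine ⟨?_, inferInstance⟩
  by_contra hne
  rw [nonempty_subtype] at hne
  push Not at hne
  exact hv (Prod.ext (funext fun i => (hne i).1) (funext fun i => (hne i).2))

lemma swtSet_le {F : Type*} [Zero F] {n : ℕ} {S : Set (SV F n)} {v : SV F n} (hv : v ∈ S)
    (h0 : v ≠ 0) : swtSet S ≤ swt v :=
  Nat.sInf_le ⟨v, ⟨hv, h0⟩, rfl⟩

lemma le_swtSet {F : Type*} [Zero F] {n m : ℕ} {S : Set (SV F n)} {v : SV F n} (hv : v ∈ S)
    (h0 : v ≠ 0) (h : ∀ w ∈ S, w ≠ 0 → m ≤ swt w) : m ≤ swtSet S := by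
  refine le_csInf ⟨_, v, ⟨hv, h0⟩, rfl⟩ ?_
  rintro _ ⟨w, ⟨hw, hw0⟩, rfl⟩
  exact h w hw hw0

section TraceSymplectic

variable {p : ℕ} {F : Type*} [Field F] [Fintype F] [CharP F p] {n : ℕ}

lemma trSymp_add_left (u v w : SV F n) :
    trSymp p (u + v) w = trSymp p u w + trSymp p v w := by
  simp only [trSymp, ← map_add]
  congr 1
  simp only [Prod.fst_add, Prod.snd_add, dotProduct_add, add_dotProduct]
  ring

lemma trSymp_swap (u v : SV F n) : trSymp p v u = -trSymp p u v := by
  simp only [trSymp, ← map_neg, neg_sub]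

lemma trSymp_add_right (u v w : SV F n) :
    trSymp p u (v + w) = trSymp p u v + trSymp p u w := by
  rw [trSymp_swap, trSymp_add_left, trSymp_swap u v, trSymp_swap u w]
  ring

/-- The trace-symplectic form as a biadditive map. -/
noncomputable def trSympHom (p : ℕ) {F : Type*} [Field F] [Fintype F] [CharP F p] {n : ℕ} :
    SV F n →+ SV F n →+ ZMod p :=
  AddMonoidHom.mk' (fun u => AddMonoidHom.mk' (trSymp p u) (trSymp_add_right u))
    fun u v => AddMonoidHom.ext fun w => trSymp_add_left u v w

lemma trSymp_succ (v w : SV F (n + 1)) :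
    letI := ZMod.algebra F p
    trSymp p v w = trSymp p ((Fin.tail v.1, Fin.tail v.2) : SV F n) (Fin.tail w.1, Fin.tail w.2) +
      Algebra.trace (ZMod p) F (w.1 0 * v.2 0 - v.1 0 * w.2 0) := by
  simp only [trSymp, ← map_add]
  congr 1
  simp only [dotProduct, Fin.sum_univ_succ, Fin.tail]
  ring

/-- The trace-symplectic dual as an additive subgroup. -/
def sdualAddSubgroup (p : ℕ) {F : Type*} [Field F] [Fintype F] [CharP F p] {n : ℕ}
    (S : Set (SV F n)) : AddSubgroup (SV F n) where
  carrier := sdual p S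
  zero_mem' w _ := DFunLike.congr_fun (map_zero (trSympHom p)) w
  add_mem' hv hv' w hw := by rw [trSymp_add_left, hv w hw, hv' w hw, add_zero]
  neg_mem' := by
    intro v hv w hw
    have h : trSymp p (-v) w = -trSymp p v w :=
      DFunLike.congr_fun (map_neg (trSympHom p) v) w
    rw [h, hv w hw, neg_zero]

variable [Fact p.Prime]

lemma sdual_extend {S : Set (SV F n)} (h0 : (0 : SV F n) ∈ S) :
    sdual p (SV.extend S) = SV.extend (sdual p S) := by
  let := ZMod.algebra F p
  ext v
  constructor
  · intro hv
    refine ⟨?_, fun w hw => ?_⟩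
    · refine traceForm_nondegenerate (ZMod p) F |>.1 _ fun a => ?_
      have h := hv _ (SV.cons_mem_extend h0 a)
      rw [trSymp_succ] at h
      have h' := map_zero (trSympHom p (F := F) (n := n) (Fin.tail v.1, Fin.tail v.2))
      change trSymp p _ (0, 0) = 0 at h'
      rw [Algebra.traceForm_apply, mul_comm]
      simpa [h'] using h
    · have h := hv _ (SV.cons_mem_extend hw 0)
      rw [trSymp_succ] at h
      simpa using h
  · rintro ⟨hv, hv'⟩ w ⟨hw, hw'⟩
    rw [trSymp_succ, hv' _ hw', hv, hw]
    simp

/-- Rank–nullity for the map sending `v` to the functional `⟨v|·⟩ₛ` on `D`. -/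
lemma card_le_card_sdual_mul_card (D : AddSubgroup (SV F n)) :
    Fintype.card F ^ (2 * n) ≤ Nat.card (sdual p (D : Set (SV F n))) * Nat.card D := by
  let := ZMod.algebra F p
  let D' : Submodule (ZMod p) (SV F n) := AddSubgroup.toZModSubmodule p D
  let f : SV F n →+ Module.Dual (ZMod p) D' :=
    AddMonoidHom.mk' (fun v => ((trSympHom p v).comp D.subtype).toZModLinearMap p)
      fun u v => LinearMap.ext fun w => trSymp_add_left u v w
  have hker : (f.ker : Set (SV F n)) = sdual p (D : Set (SV F n)) := by
    ext v
    refine ⟨fun hv w hw => ?_, fun hv => LinearMap.ext fun w => hv w w.2⟩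
    exact LinearMap.congr_fun (show f v = 0 from hv) ⟨w, hw⟩
  have hdual : Nat.card (Module.Dual (ZMod p) D') = Nat.card D := by
    change _ = Nat.card D'
    rw [Module.natCard_eq_pow_finrank (K := ZMod p), Subspace.dual_finrank_eq,
      ← Module.natCard_eq_pow_finrank]
  have hV : Nat.card (SV F n) = Fintype.card F ^ (2 * n) := by
    rw [Nat.card_prod, Nat.card_fun, Nat.card_fin, Nat.card_eq_fintype_card]
    ring
  have : Finite (Module.Dual (ZMod p) D') := Module.finite_of_finite (ZMod p)
  rw [← hV, ← hker, ← hdual, AddSubgroup.card_eq_card_quotient_mul_card_addSubgroup f.ker, mul_comm]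
  refine Nat.mul_le_mul_left _ ?_
  exact Nat.card_le_card_of_injective _ (QuotientAddGroup.kerLift_injective f)

lemma sdual_ne_of_one_lt {K : ℕ} {C : AddSubgroup (SV F n)}
    (hcard : K ^ 2 * (Nat.card C * Nat.card ↥((C : Set (SV F n)) ∩ sdual p (C : Set (SV F n)))) =
      Fintype.card F ^ (2 * n)) (hK : 1 < K) :
    sdual p ((C : Set (SV F n)) ∩ sdual p (C : Set (SV F n))) ≠ (C : Set (SV F n)) := by
  intro heq
  have hle := card_le_card_sdual_mul_card (p := p) (C ⊓ sdualAddSubgroup p (C : Set (SV F n)))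
  change _ ≤ Nat.card (sdual p ((C : Set (SV F n)) ∩ sdual p (C : Set (SV F n)))) *
    Nat.card ↥((C : Set (SV F n)) ∩ sdual p (C : Set (SV F n))) at hle
  rw [heq, ← hcard] at hle
  change K ^ 2 * (Nat.card C * _) ≤ Nat.card C * _ at hle
  have hpos : 0 < Nat.card C *
      Nat.card ↥((C : Set (SV F n)) ∩ sdual p (C : Set (SV F n))) := by
    refine Nat.pos_of_ne_zero fun h => ?_
    rw [h, mul_zero] at hcard
    exact (pow_pos Fintype.card_pos _).ne hcard
  exact (lt_mul_of_one_lt_left hpos (Nat.one_lt_pow two_ne_zero hK)).not_ge hle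

end TraceSymplectic

/-- Extending a subsystem code: an `((n,K,R,d))_q` subsystem code with `K > 1` yields an
`((n+1,K,R,≥d))_q` subsystem code that is pure to 1. -/
theorem stmt1 {p : ℕ} [Fact p.Prime] {F : Type} [Field F] [Fintype F] [CharP F p]
    {n K R d : ℕ} (C : AddSubgroup (SV F n))
    (h : IsSubsystemCode p K R d C) (hK : 1 < K) :
    ∃ (C' : AddSubgroup (SV F (n + 1))) (d' : ℕ),
      d ≤ d' ∧ IsSubsystemCode p K R d' C' ∧ PureTo p 1 C' := by
  obtain ⟨hC, hcard, hR, hd⟩ := h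
  set D : Set (SV F n) := (C : Set (SV F n)) ∩ sdual p (C : Set (SV F n)) with hD
  have hne : sdual p D ≠ (C : Set (SV F n)) := sdual_ne_of_one_lt hcard hK
  have hD0 : (0 : SV F n) ∈ D := ⟨C.zero_mem, (sdualAddSubgroup p _).zero_mem⟩
  have hDext : SV.extend (C : Set (SV F n)) ∩ sdual p (SV.extend (C : Set (SV F n))) =
      SV.extend D := by
    rw [sdual_extend C.zero_mem, ← SV.extend_inter]
  have hCard : Nat.card (SV.extendAddSubgroup C) = Fintype.card F * Nat.card C :=
    SV.card_extend (C : Set (SV F n))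
  have hCD : (C : Set (SV F n)) ⊆ sdual p D := fun v hv w hw => by
    rw [trSymp_swap, hw.2 v hv, neg_zero]
  obtain ⟨v, hv, hvC⟩ : ∃ v ∈ sdual p D, v ∉ (C : Set (SV F n)) := by
    by_contra! hsub
    exact hne (Set.Subset.antisymm hsub hCD)
  have hone : ((Fin.cons 1 0, Fin.cons 0 0) : SV F (n + 1)) ≠ 0 := fun h =>
    one_ne_zero (congrFun (congrArg Prod.fst h) 0)
  have hmem : ((Fin.cons 0 v.1, Fin.cons 0 v.2) : SV F (n + 1)) ∈
      SV.extend (sdual p D \ (C : Set (SV F n))) := SV.cons_mem_extend (Set.mem_sdiff_of_mem hv hvC) 0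
  have hnz : ∀ w ∈ SV.extend (sdual p D \ (C : Set (SV F n))),
      ((Fin.tail w.1, Fin.tail w.2) : SV F n) ≠ 0 := fun w hw h =>
    hw.2.2 (h ▸ C.zero_mem)
  have hext : SV.extend (sdual p D) ≠ SV.extend (C : Set (SV F n)) := fun h => by
    rw [SV.extend_diff, h, Set.sdiff_self] at hmem
    exact hmem
  rw [if_neg hne] at hd
  refine ⟨SV.extendAddSubgroup C, swtSet (SV.extend (sdual p D \ (C : Set (SV F n)))),
    ?_, ⟨?_, ?_, ?_, ?_⟩, ?_⟩
  · rw [hd]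
    exact le_swtSet hmem (fun h => hnz _ hmem (by rw [h]; rfl)) fun w hw _ =>
      (swtSet_le hw.2 (hnz w hw)).trans (swt_tail_le w)
  · intro h
    have hmem' : ((Fin.cons 1 0, Fin.cons 0 0) : SV F (n + 1)) ∈ SV.extendAddSubgroup C :=
      SV.cons_mem_extend C.zero_mem 1
    rw [h, AddSubgroup.mem_bot] at hmem'
    exact hone hmem'
  · rw [hCard, SV.coe_extendAddSubgroup, hDext, SV.card_extend, mul_add, pow_add, ← hcard]
    ring
  · rw [hCard, SV.coe_extendAddSubgroup, hDext, SV.card_extend, ← hR]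
    ring
  · rw [SV.coe_extendAddSubgroup, hDext, sdual_extend hD0, if_neg hext, SV.extend_diff]
  · rw [PureTo, SV.coe_extendAddSubgroup, hDext, sdual_extend hD0]
    exact le_swtSet (SV.cons_mem_extend (S := sdual p D) (sdualAddSubgroup p D).zero_mem 1) hone
      fun w _ hw => swt_pos hw
end

section
/- Let q be a power of a prime p. If there exists an additive subgroup of F_q^{2n} defining a subsystem code with parameters ((n,K,R,d))_q with K > p that is pure to d', then there exists an additive subgroup of F_q^{2n} defining a subsystem code with parameters ((n, K/p, pR, d''))_q with d'' ≥ d that is pure to min{d, d'}. Moreover, if there exists an additive subgroup of F_q^{2n} defining a pure subsystem code with parameters ((n, p, R, d))_q, then there exists an additive subgroup of F_q^{2n} defining a subsystem code with parameters ((n, 1, pR, d))_q. -/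
open Matrix
open scoped Classical

/-- Adjoining a hyperbolic pair of `C^⊥` to a subspace `C` with `C^⊥ ≰ C` raises the dimension by
two and does not change the radical. -/
theorem LinearMap.BilinForm.exists_hyperbolic_extension {k V : Type*} [Field k] [AddCommGroup V]
    [Module k V] [FiniteDimensional k V] {B : LinearMap.BilinForm k V} (hB : B.Nondegenerate)
    (hB' : B.IsAlt) (C : Submodule k V) (hC : ¬ B.orthogonal C ≤ C) :
    ∃ C' : Submodule k V, C ≤ C' ∧ C' ⊓ B.orthogonal C' = C ⊓ B.orthogonal C ∧
      Module.finrank k C' = Module.finrank k C + 2 := by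
  obtain ⟨v, hv, hvC⟩ := SetLike.not_le_iff_exists.1 hC
  obtain ⟨w, hw, hwv⟩ : ∃ w ∈ B.orthogonal C, B w v ≠ 0 := by
    by_contra! h
    rw [← LinearMap.BilinForm.orthogonal_orthogonal hB hB'.isRefl C] at hvC
    exact hvC h
  have hvw : B v w ≠ 0 := fun h => hwv (hB'.isRefl _ _ h)
  have hvv : B v v = 0 := hB' v
  have hww : B w w = 0 := hB' w
  rw [LinearMap.BilinForm.mem_orthogonal_iff] at hv hw
  have coeff_eq_zero : ∀ c ∈ C, ∀ a b : k, B v (c + (a • v + b • w)) = 0 →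
      B w (c + (a • v + b • w)) = 0 → a = 0 ∧ b = 0 := by
    intro c hc a b h₁ h₂
    have hvc := hB'.isRefl _ _ (hv c hc)
    have hwc := hB'.isRefl _ _ (hw c hc)
    simp_all
  have hli : LinearIndependent k ![v, w] := by
    rw [LinearIndependent.pair_iff]
    intro a b h
    exact coeff_eq_zero 0 C.zero_mem a b (by simp [h]) (by simp [h])
  have hdisj : C ⊓ Submodule.span k {v, w} = ⊥ := by
    rw [eq_bot_iff]
    rintro x ⟨hxC, hx⟩
    obtain ⟨a, b, rfl⟩ := Submodule.mem_span_pair.1 hx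
    obtain ⟨rfl, rfl⟩ := coeff_eq_zero (-(a • v + b • w)) (C.neg_mem hxC) a b (by simp) (by simp)
    simp
  refine ⟨C ⊔ Submodule.span k {v, w}, le_sup_left, le_antisymm ?_ ?_, ?_⟩
  · rintro x ⟨hx, hx'⟩
    obtain ⟨c, hc, y, hy, rfl⟩ := Submodule.mem_sup.1 hx
    obtain ⟨a, b, rfl⟩ := Submodule.mem_span_pair.1 hy
    have hmem : ∀ u ∈ ({v, w} : Set V), u ∈ C ⊔ Submodule.span k {v, w} := fun u hu =>
      Submodule.mem_sup_right (Submodule.subset_span hu)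
    obtain ⟨rfl, rfl⟩ := coeff_eq_zero c hc a b (hx' v (hmem v (by simp)))
      (hx' w (hmem w (by simp)))
    exact ⟨by simpa using hc, LinearMap.BilinForm.orthogonal_le le_sup_left hx'⟩
  · rintro x ⟨hx, hx'⟩
    refine ⟨Submodule.mem_sup_left hx, fun y hy => ?_⟩
    obtain ⟨c, hc, z, hz, rfl⟩ := Submodule.mem_sup.1 hy
    obtain ⟨a, b, rfl⟩ := Submodule.mem_span_pair.1 hz
    have hcx : B c x = 0 := hx' c hc
    have hvx := hB'.isRefl _ _ (hv x hx)
    have hwx := hB'.isRefl _ _ (hw x hx)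
    simp [hcx, hvx, hwx]
  · have h := Submodule.finrank_sup_add_finrank_inf_eq C (Submodule.span k {v, w})
    have h2 := finrank_span_eq_card hli
    rw [Matrix.range_cons_cons_empty, Fintype.card_fin] at h2
    rw [hdisj, finrank_bot, h2, add_zero] at h
    exact h

section TraceSymplectic

variable {p : ℕ} {F : Type*} [Field F] {n : ℕ}

/-- The trace-symplectic form, with its arguments exchanged, as a bilinear form over the prime
field. The exchange makes `LinearMap.BilinForm.orthogonal` agree with `sdual`. -/
noncomputable def trSympForm [Algebra (ZMod p) F] :
    LinearMap.BilinForm (ZMod p) (SV F n) :=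
  LinearMap.mk₂ (ZMod p) (fun u v => Algebra.trace (ZMod p) F (u.1 ⬝ᵥ v.2 - v.1 ⬝ᵥ u.2))
    (fun u u' v => by rw [← map_add]; simp [add_dotProduct, dotProduct_add]; ring)
    (fun c u v => by rw [← map_smul]; simp [smul_sub])
    (fun u v v' => by rw [← map_add]; simp [add_dotProduct, dotProduct_add]; ring)
    (fun c u v => by rw [← map_smul]; simp [smul_sub])

theorem trSympForm_apply [Algebra (ZMod p) F] (u v : SV F n) :
    trSympForm (p := p) u v = Algebra.trace (ZMod p) F (u.1 ⬝ᵥ v.2 - v.1 ⬝ᵥ u.2) := rfl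

theorem trSympForm_isAlt [Algebra (ZMod p) F] :
    (trSympForm : LinearMap.BilinForm (ZMod p) (SV F n)).IsAlt := fun u => by
  simp [trSympForm_apply]

theorem trSympForm_nondegenerate [Fact p.Prime] [Finite F] [Algebra (ZMod p) F] :
    (trSympForm : LinearMap.BilinForm (ZMod p) (SV F n)).Nondegenerate := by
  have trace_eq_zero : ∀ a : F, (∀ b, Algebra.trace (ZMod p) F (a * b) = 0) → a = 0 :=
    (traceForm_nondegenerate (ZMod p) F).1
  have hrefl := (trSympForm_isAlt (p := p) (F := F) (n := n)).isRefl
  refine (LinearMap.IsRefl.nondegenerate_iff_separatingLeft hrefl).2 fun u hu => ?_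
  ext i
  · refine trace_eq_zero _ fun b => ?_
    simpa [trSympForm_apply] using hu (0, Pi.single i b)
  · refine trace_eq_zero _ fun b => ?_
    simpa [trSympForm_apply, mul_comm] using hu (Pi.single i b, 0)

theorem exists_extension_same_radical [Fact p.Prime] [Fintype F] [CharP F p]
    (C : AddSubgroup (SV F n)) {K : ℕ} (hK : 1 < K)
    (hcard : K ^ 2 * (Nat.card C * Nat.card ↥((C : Set (SV F n)) ∩ sdual p (C : Set (SV F n)))) =
      Fintype.card F ^ (2 * n)) :
    ∃ C' : AddSubgroup (SV F n), C ≤ C' ∧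
      (C' : Set (SV F n)) ∩ sdual p (C' : Set (SV F n)) =
        (C : Set (SV F n)) ∩ sdual p (C : Set (SV F n)) ∧
      Nat.card C' = p ^ 2 * Nat.card C ∧
      (C' : Set (SV F n)) ⊆ sdual p ((C : Set (SV F n)) ∩ sdual p (C : Set (SV F n))) ∧
      Nat.card (sdual p ((C : Set (SV F n)) ∩ sdual p (C : Set (SV F n)))) =
        K ^ 2 * Nat.card C := by
  let _ := ZMod.algebra F p
  let B : LinearMap.BilinForm (ZMod p) (SV F n) := trSympForm
  let S : Submodule (ZMod p) (SV F n) := AddSubgroup.toZModSubmodule p C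
  have hB : B.Nondegenerate := trSympForm_nondegenerate
  have hB' : B.IsAlt := trSympForm_isAlt
  have card_mul_orthogonal : ∀ T : Submodule (ZMod p) (SV F n),
      Nat.card T * Nat.card (B.orthogonal T) = Fintype.card F ^ (2 * n) := by
    intro T
    have hV : Nat.card (SV F n) = Fintype.card F ^ (2 * n) := by
      simp [Nat.card_eq_fintype_card, two_mul, pow_add]
    rw [← hV, Module.natCard_eq_pow_finrank (K := ZMod p) (V := T),
      Module.natCard_eq_pow_finrank (K := ZMod p) (V := B.orthogonal T),
      Module.natCard_eq_pow_finrank (K := ZMod p) (V := SV F n), ← pow_add,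
      LinearMap.BilinForm.finrank_orthogonal hB, Nat.add_sub_cancel' T.finrank_le]
  have hD : K ^ 2 * (Nat.card S * Nat.card ↥(S ⊓ B.orthogonal S)) = Fintype.card F ^ (2 * n) :=
    hcard
  have hSpos : 0 < Nat.card S := Nat.card_pos
  have hDpos : 0 < Nat.card ↥(S ⊓ B.orthogonal S) := Nat.card_pos
  have hS : ¬ B.orthogonal S ≤ S := by
    intro h
    rw [inf_eq_right.2 h, card_mul_orthogonal S] at hD
    have hpos : 0 < Fintype.card F ^ (2 * n) := pow_pos Fintype.card_pos _
    have : 1 < K ^ 2 := Nat.one_lt_pow two_ne_zero hK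
    nlinarith
  obtain ⟨T, hST, hrad, hfin⟩ := LinearMap.BilinForm.exists_hyperbolic_extension hB hB' S hS
  refine ⟨T.toAddSubgroup, hST, congrArg SetLike.coe hrad, ?_, fun x hx => ?_, ?_⟩
  · change Nat.card T = p ^ 2 * Nat.card S
    rw [Module.natCard_eq_pow_finrank (K := ZMod p) (V := T),
      Module.natCard_eq_pow_finrank (K := ZMod p) (V := S), hfin, Nat.card_zmod, pow_add, mul_comm]
  · intro y hy
    have hy' : y ∈ T ⊓ B.orthogonal T := hrad ▸ hy
    exact hB'.isRefl _ _ (hy'.2 x hx)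
  · change Nat.card (B.orthogonal (S ⊓ B.orthogonal S)) = K ^ 2 * Nat.card S
    refine Nat.eq_of_mul_eq_mul_left hDpos ?_
    rw [card_mul_orthogonal, ← hD]
    ring

end TraceSymplectic

theorem swtSet_le_swtSet_diff {F : Type*} [Field F] {n : ℕ} {S T : Set (SV F n)}
    {C : AddSubgroup (SV F n)} (hST : S \ C ⊆ T) (hSC : ¬ S ⊆ C) :
    swtSet T ≤ swtSet (S \ C) := by
  obtain ⟨v, hv, hvC⟩ := Set.not_subset.1 hSC
  exact csInf_le_csInf (OrderBot.bddBelow _)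
    ⟨_, v, ⟨⟨hv, hvC⟩, fun h => hvC (h ▸ C.zero_mem)⟩, rfl⟩
    (Set.image_mono fun u hu => ⟨hST hu.1, hu.2⟩)

/-- Trading dimensions: an `((n,K,R,d))_q` subsystem code with `K > p` pure to `d'` gives an
`((n,K/p,pR,≥d))_q` subsystem code pure to `min d d'`; a pure `((n,p,R,d))_q` subsystem code
gives an `((n,1,pR,d))_q` subsystem code. -/
theorem stmt3 {p : ℕ} [Fact p.Prime] {F : Type} [Field F] [Fintype F] [CharP F p] {n : ℕ} :
    (∀ (K R d d' : ℕ) (C : AddSubgroup (SV F n)),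
      IsSubsystemCode p K R d C → PureTo p d' C → p < K →
      ∃ (C₂ : AddSubgroup (SV F n)) (d'' : ℕ), d ≤ d'' ∧
        IsSubsystemCode p (K / p) (p * R) d'' C₂ ∧ PureTo p (min d d') C₂) ∧
    (∀ (R d : ℕ) (C : AddSubgroup (SV F n)),
      IsSubsystemCode p p R d C → PureTo p d C →
      ∃ C₃ : AddSubgroup (SV F n), IsSubsystemCode p 1 (p * R) d C₃) := by
  have hp : p.Prime := Fact.out
  refine ⟨fun K R d d' C ⟨hbot, hcard, hR, hd⟩ hpure hK => ?_,
    fun R d C ⟨hbot, hcard, hR, hd⟩ hpure => ?_⟩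
  · obtain ⟨m, rfl⟩ : ∃ m, K = p ^ m := by
      obtain ⟨e, -, hq⟩ := FiniteField.card F p
      refine ((Nat.dvd_prime_pow hp (m := e * (2 * n))).1 ?_).imp fun _ h => h.2
      rw [pow_mul, ← hq, ← hcard]
      exact (dvd_pow_self K two_ne_zero).mul_right _
    obtain ⟨L, hL, hKL⟩ : ∃ L, 1 < L ∧ p ^ m = p * L := by
      obtain ⟨k, rfl⟩ : ∃ k, m = k + 1 := Nat.exists_eq_succ_of_ne_zero (by
        rintro rfl
        exact hK.not_ge (by simpa using hp.one_lt.le))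
      refine ⟨p ^ k, ?_, pow_succ' p k⟩
      rw [pow_succ'] at hK
      exact lt_of_mul_lt_mul_left (by simpa using hK) p.zero_le
    rw [hKL] at hcard ⊢
    obtain ⟨C', hCC', hrad, hcard', hsub, hdual⟩ := exists_extension_same_radical C
      (hp.one_lt.trans_le (Nat.le_mul_of_pos_right p (by omega))) hcard
    rw [Nat.mul_div_cancel_left L hp.pos]
    have hpos : 0 < Nat.card C := Nat.card_pos
    have hne' : ¬ sdual p ((C : Set (SV F n)) ∩ sdual p (C : Set (SV F n))) ⊆ C' := by
      intro h
      have h' := Nat.card_mono (Set.toFinite _) h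
      rw [hdual] at h'
      change _ ≤ Nat.card C' at h'
      rw [hcard', mul_pow, mul_assoc] at h'
      have h2 := le_of_mul_le_mul_left h' (pow_pos hp.pos 2)
      have : 1 < L ^ 2 := Nat.one_lt_pow two_ne_zero hL
      nlinarith
    have hne : ¬ sdual p ((C : Set (SV F n)) ∩ sdual p (C : Set (SV F n))) ⊆ C :=
      fun h => hne' (h.trans hCC')
    rw [if_neg fun h => hne h.subset] at hd
    refine ⟨C', _, ?_, ⟨fun h => hbot (le_bot_iff.1 (h ▸ hCC')), ?_, ?_, rfl⟩, ?_⟩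
    · rw [hrad, if_neg fun h => hne' h.subset, hd]
      exact swtSet_le_swtSet_diff (Set.sdiff_subset_sdiff_right hCC') hne'
    · rw [hrad, hcard', ← hcard]
      ring
    · rw [hrad, hcard', ← hR]
      ring
    · rw [PureTo, hrad]
      exact (min_le_right _ _).trans hpure
  · obtain ⟨C', hCC', hrad, hcard', hsub, hdual⟩ :=
      exists_extension_same_radical C hp.one_lt hcard
    have heq : (C' : Set (SV F n)) = sdual p ((C : Set (SV F n)) ∩ sdual p (C : Set (SV F n))) :=
      Set.eq_of_subset_of_ncard_le hsub (by
        rw [← Nat.card_coe_set_eq, ← Nat.card_coe_set_eq, hdual]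
        exact hcard'.ge) (Set.toFinite _)
    have hpos : 0 < Nat.card C := Nat.card_pos
    have hne : ¬ sdual p ((C : Set (SV F n)) ∩ sdual p (C : Set (SV F n))) ⊆ C := by
      intro h
      have h' := Nat.card_mono (Set.toFinite _) h
      rw [hdual] at h'
      change _ ≤ Nat.card C at h'
      have : 1 < p ^ 2 := Nat.one_lt_pow two_ne_zero hp.one_lt
      nlinarith
    rw [if_neg fun h => hne h.subset] at hd
    refine ⟨C', fun h => hbot (le_bot_iff.1 (h ▸ hCC')), ?_, ?_, ?_⟩
    · rw [hrad, hcard', ← hcard]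
      ring
    · rw [hrad, hcard', ← hR]
      ring
    · rw [hrad, if_pos heq.symm]
      exact le_antisymm hpure (hd ▸ swtSet_le_swtSet_diff Set.sdiff_subset hne)
end

section
/- If there exists an additive subgroup C ≤ F_q^{2n} with C ⊆ C^⊥s defining a stabilizer code with parameters [[n,k,d]]_q that is pure to d', then for every integer r in the range 0 ≤ r < k there exists an additive subgroup C_r ≤ F_q^{2n} defining a subsystem code with parameters [[n, k−r, r, d_r]]_q with d_r ≥ d that is pure to min{d, d'}. The same holds with 'additive subgroup' replaced by 'F_q-linear subspace' throughout. -/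
open Matrix
open scoped Classical

section HyperbolicExtension

open Module

variable {K V : Type*} [Field K] [AddCommGroup V] [Module K V] [FiniteDimensional K V]

/-- A subspace `W` with a vector pair `x, y ∈ W^⊥`, `B x y ≠ 0`, adjoined: the dimension grows by
two and the radical does not change. -/
theorem LinearMap.BilinForm.IsAlt.sup_span_pair {B : LinearMap.BilinForm K V} (hB : B.IsAlt)
    {W : Submodule K V} {x y : V} (hx : x ∈ B.orthogonal W) (hy : y ∈ B.orthogonal W)
    (hxy : B x y ≠ 0) :
    (W ⊔ Submodule.span K {x, y}) ⊓ B.orthogonal (W ⊔ Submodule.span K {x, y}) =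
        W ⊓ B.orthogonal W ∧
      finrank K ↥(W ⊔ Submodule.span K {x, y}) = finrank K W + 2 := by
  have hyx : B y x ≠ 0 := fun h => hxy (hB.isRefl _ _ h)
  rw [LinearMap.BilinForm.mem_orthogonal_iff] at hx hy
  have hx' : ∀ w ∈ W, B x w = 0 := fun w hw => hB.isRefl _ _ (hx w hw)
  have hy' : ∀ w ∈ W, B y w = 0 := fun w hw => hB.isRefl _ _ (hy w hw)
  have hxW : x ∈ W ⊔ Submodule.span K {x, y} :=
    le_sup_right (a := W) (Submodule.subset_span (by simp))
  have hyW : y ∈ W ⊔ Submodule.span K {x, y} :=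
    le_sup_right (a := W) (Submodule.subset_span (by simp))
  have key : ∀ w ∈ W, ∀ a b : K, B x (w + (a • x + b • y)) = 0 →
      B y (w + (a • x + b • y)) = 0 → a = 0 ∧ b = 0 := by
    intro w hw a b h1 h2
    simp only [map_add, map_smul, hx' w hw, hy' w hw, hB x, hB y, smul_eq_mul, mul_zero, zero_add,
      add_zero, mul_eq_zero, hxy, hyx, or_false] at h1 h2
    exact ⟨h2, h1⟩
  constructor
  · ext v
    simp only [Submodule.mem_inf, LinearMap.BilinForm.mem_orthogonal_iff]
    constructor
    · rintro ⟨hv, hvo⟩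
      obtain ⟨w, hw, z, hz, rfl⟩ := Submodule.mem_sup.1 hv
      obtain ⟨a, b, rfl⟩ := Submodule.mem_span_pair.1 hz
      obtain ⟨rfl, rfl⟩ := key w hw a b (hvo x hxW) (hvo y hyW)
      simp only [zero_smul, add_zero] at hvo ⊢
      exact ⟨hw, fun u hu => hvo u (le_sup_left (b := Submodule.span K {x, y}) hu)⟩
    · rintro ⟨hv, hvo⟩
      refine ⟨le_sup_left (b := Submodule.span K {x, y}) hv, fun u hu => ?_⟩
      obtain ⟨w, hw, z, hz, rfl⟩ := Submodule.mem_sup.1 hu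
      obtain ⟨a, b, rfl⟩ := Submodule.mem_span_pair.1 hz
      simp [hvo w hw, hx' v hv, hy' v hv]
  · have hdisj : W ⊓ Submodule.span K {x, y} = ⊥ := by
      refine (Submodule.eq_bot_iff _).2 ?_
      rintro v ⟨hv, hvs⟩
      obtain ⟨a, b, rfl⟩ := Submodule.mem_span_pair.1 hvs
      obtain ⟨rfl, rfl⟩ := key 0 W.zero_mem a b (by rw [zero_add]; exact hx' _ hv)
        (by rw [zero_add]; exact hy' _ hv)
      simp
    have hli : LinearIndependent K ![x, y] := by
      refine LinearIndependent.pair_iff.2 fun a b hab => ?_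
      exact key 0 W.zero_mem a b (by simp [hab]) (by simp [hab])
    have h2 : finrank K ↥(Submodule.span K {x, y}) = 2 := by
      have := finrank_span_eq_card hli
      rwa [Matrix.range_cons_cons_empty, Fintype.card_fin] at this
    have := Submodule.finrank_sup_add_finrank_inf_eq W (Submodule.span K {x, y})
    rwa [hdisj, finrank_bot, add_zero, h2] at this

/-- A totally isotropic subspace `C` is the radical of subspaces `W` with `C ≤ W ≤ C^⊥` of
every dimension `dim C + 2m ≤ dim C^⊥`. -/
theorem LinearMap.BilinForm.IsAlt.exists_radical_eq {B : LinearMap.BilinForm K V}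
    (hB : B.IsAlt) (hnd : B.Nondegenerate) {C : Submodule K V} (hC : C ≤ B.orthogonal C) (m : ℕ)
    (hm : finrank K C + 2 * m ≤ finrank K (B.orthogonal C)) :
    ∃ W : Submodule K V, C ≤ W ∧ W ≤ B.orthogonal C ∧ W ⊓ B.orthogonal W = C ∧
      finrank K W = finrank K C + 2 * m := by
  induction m with
  | zero => exact ⟨C, le_rfl, hC, inf_eq_left.2 hC, rfl⟩
  | succ m ih =>
    obtain ⟨W, hCW, hWC, hrad, hdim⟩ := ih (by omega)
    have hanti : B.orthogonal W ≤ B.orthogonal C := B.orthogonal_le hCW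
    obtain ⟨x, hx, y, hy, hxy⟩ : ∃ x ∈ B.orthogonal W, ∃ y ∈ B.orthogonal W, B x y ≠ 0 := by
      by_contra! hcon
      have hle : B.orthogonal W ≤ W := by
        conv_rhs => rw [← LinearMap.BilinForm.orthogonal_orthogonal hnd hB.isRefl W]
        exact fun y hy => LinearMap.BilinForm.mem_orthogonal_iff.2 fun x hx => hcon x hx y hy
      have hWC' : B.orthogonal C = W := by
        rw [← hrad, inf_eq_right.2 hle, LinearMap.BilinForm.orthogonal_orthogonal hnd hB.isRefl]
      rw [hWC', hdim] at hm
      omega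
    obtain ⟨h1, h2⟩ := hB.sup_span_pair hx hy hxy
    refine ⟨W ⊔ Submodule.span K {x, y}, hCW.trans le_sup_left, sup_le hWC ?_, h1.trans hrad,
      by omega⟩
    rw [Submodule.span_le]
    rintro z (rfl | rfl)
    exacts [hanti hx, hanti hy]

end HyperbolicExtension

section SymplecticForm

variable {K F : Type*} [Field K] [Field F] [Algebra K F] {n : ℕ}

/-- The form `f (v₁·u₂ − u₁·v₂)` on `F^{2n}` induced by a `K`-linear functional `f` of `F`. -/
noncomputable def sympForm (n : ℕ) (f : F →ₗ[K] K) : LinearMap.BilinForm K (SV F n) :=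
  LinearMap.mk₂ K (fun u v => f (v.1 ⬝ᵥ u.2 - u.1 ⬝ᵥ v.2))
    (fun u u' v => by
      rw [← map_add]; congr 1; simp only [Prod.fst_add, Prod.snd_add, dotProduct_add,
        add_dotProduct]; ring)
    (fun c u v => by
      rw [← map_smul]; congr 1; simp [dotProduct_smul, smul_dotProduct, smul_sub])
    (fun u v v' => by
      rw [← map_add]; congr 1; simp only [Prod.fst_add, Prod.snd_add, dotProduct_add,
        add_dotProduct]; ring)
    (fun c u v => by
      rw [← map_smul]; congr 1; simp [dotProduct_smul, smul_dotProduct, smul_sub])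

theorem sympForm_apply (f : F →ₗ[K] K) (u v : SV F n) :
    sympForm n f u v = f (v.1 ⬝ᵥ u.2 - u.1 ⬝ᵥ v.2) := rfl

theorem sympForm_isAlt (f : F →ₗ[K] K) : (sympForm n f).IsAlt := fun u => by
  simp [sympForm_apply]

theorem sympForm_nondegenerate {f : F →ₗ[K] K} (hf : f ≠ 0) : (sympForm n f).Nondegenerate := by
  refine (sympForm_isAlt f).isRefl.nondegenerate_iff_separatingLeft.2 fun u hu => ?_
  obtain ⟨b, hb⟩ : ∃ b, f b ≠ 0 := by
    by_contra! h
    exact hf (LinearMap.ext h)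
  ext i
  · by_contra h
    refine hb ?_
    simpa [sympForm_apply, mul_div_cancel₀ _ h] using hu (0, Pi.single i (-(b / u.1 i)))
  · by_contra h
    refine hb ?_
    simpa [sympForm_apply, div_mul_cancel₀ _ h] using hu (Pi.single i (b / u.2 i), 0)

end SymplecticForm

theorem swtSet_anti {F : Type*} [Zero F] {n : ℕ} {S T : Set (SV F n)} (h : S ⊆ T)
    (hne : ∃ v ∈ S, v ≠ 0) : swtSet T ≤ swtSet S := by
  obtain ⟨v, hv, hv0⟩ := hne
  exact csInf_le_csInf (OrderBot.bddBelow _) ⟨_, v, ⟨hv, hv0⟩, rfl⟩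
    (Set.image_mono fun w hw => ⟨h hw.1, hw.2⟩)

/-- Subsystem codes from a self-orthogonal `C` that is linear over a field `K`, where the
trace-symplectic duals of `K`-subspaces are their orthogonals for a symplectic `K`-form `B`. -/
theorem exists_subsystemCode_of_stabilizerCode {p : ℕ} {F K : Type*} [Field F]
    [Fintype F] [CharP F p] [Field K] [Algebra K F] {n k d d' : ℕ}
    {B : LinearMap.BilinForm K (SV F n)} (hB : B.IsAlt) (hnd : B.Nondegenerate)
    (hdual : ∀ S : Submodule K (SV F n),
      sdual p (S : Set (SV F n)) = (B.orthogonal S : Set (SV F n)))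
    (C : Submodule K (SV F n)) (hC : (C : Set (SV F n)) ⊆ sdual p (C : Set (SV F n)))
    (hcode : IsSubsystemCode p (Fintype.card F ^ k) 1 d C.toAddSubgroup)
    (hpure : PureTo p d' C.toAddSubgroup) {r : ℕ} (hr : r < k) :
    ∃ (Cr : Submodule K (SV F n)) (dr : ℕ), d ≤ dr ∧
      IsSubsystemCode p (Fintype.card F ^ (k - r)) (Fintype.card F ^ r) dr Cr.toAddSubgroup ∧
      PureTo p (min d d') Cr.toAddSubgroup := by
  have : Finite K := Finite.of_injective _ (algebraMap K F).injective
  have hK : 1 < Nat.card K := Finite.one_lt_card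
  have hdim : ∀ S : Submodule K (SV F n), Nat.card S = Nat.card K ^ Module.finrank K S :=
    fun S => Module.natCard_eq_pow_finrank
  have hF : Fintype.card F = Nat.card K ^ Module.finrank K F := by
    rw [← Nat.card_eq_fintype_card, Module.natCard_eq_pow_finrank (K := K)]
  have he : 0 < Module.finrank K F := Module.finrank_pos
  have hV : Module.finrank K (SV F n) = Module.finrank K F * (2 * n) := by
    rw [Module.finrank_prod, Module.finrank_pi_fintype]
    simp
    ring
  unfold IsSubsystemCode PureTo at *
  simp only [Submodule.coe_toAddSubgroup] at *
  rw [Set.inter_eq_left.2 hC] at hcode hpure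
  obtain ⟨hbot, hcard, -, hd⟩ := hcode
  have hCo : C ≤ B.orthogonal C := by
    rw [hdual] at hC
    exact hC
  have hcC : Module.finrank K F * k + Module.finrank K C = Module.finrank K F * n := by
    have h1 : Nat.card C.toAddSubgroup = Nat.card C := rfl
    have h2 : Nat.card ↥(C : Set (SV F n)) = Nat.card C := rfl
    rw [h1, h2, hdim, hF, ← pow_mul, ← pow_mul, ← pow_mul, ← pow_add, ← pow_add] at hcard
    have := Nat.pow_right_injective hK hcard
    linarith
  have hco : Module.finrank K (B.orthogonal C) =
      Module.finrank K C + 2 * (Module.finrank K F * k) := by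
    rw [LinearMap.BilinForm.finrank_orthogonal hnd, hV]
    have : Module.finrank K F * (2 * n) = 2 * (Module.finrank K F * n) := by ring
    omega
  have hrk : Module.finrank K F * r < Module.finrank K F * k := Nat.mul_lt_mul_of_pos_left hr he
  obtain ⟨W, hCW, hWC, hrad, hW⟩ :=
    hB.exists_radical_eq hnd hCo (Module.finrank K F * r) (by omega)
  have hradS : (W : Set (SV F n)) ∩ sdual p (W : Set (SV F n)) = C := by
    rw [hdual, ← Submodule.coe_inf, hrad]
  have hneW : sdual p (C : Set (SV F n)) ≠ W := by
    rw [hdual]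
    intro h
    rw [SetLike.coe_injective h] at hco
    omega
  have hneC : sdual p (C : Set (SV F n)) ≠ C := by
    rw [hdual]
    intro h
    rw [SetLike.coe_injective h] at hco
    omega
  refine ⟨W, _, ?_, ⟨?_, ?_, ?_, rfl⟩, ?_⟩
  · rw [hradS, if_neg hneW, hd, if_neg hneC]
    refine swtSet_anti (Set.sdiff_subset_sdiff_right hCW) ?_
    obtain ⟨v, hv, hvW⟩ := Set.exists_of_ssubset
      (LE.le.ssubset_of_ne (by rw [hdual]; exact hWC) hneW.symm)
    exact ⟨v, ⟨hv, hvW⟩, fun h => hvW (h ▸ W.zero_mem)⟩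
  · intro h
    refine hbot (le_bot_iff.1 ?_)
    rw [← h]
    exact hCW
  · rw [hradS]
    have h1 : Nat.card W.toAddSubgroup = Nat.card W := rfl
    have h2 : Nat.card ↥(C : Set (SV F n)) = Nat.card C := rfl
    rw [h1, h2, hdim, hdim, hW, hF, ← pow_mul, ← pow_mul, ← pow_mul, ← pow_add, ← pow_add]
    congr 1
    have : Module.finrank K F * (k - r) = Module.finrank K F * k - Module.finrank K F * r :=
      Nat.mul_sub ..
    have : Module.finrank K F * (2 * n) = 2 * (Module.finrank K F * n) := by ring
    have : Module.finrank K F * ((k - r) * 2) = 2 * (Module.finrank K F * (k - r)) := by ring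
    omega
  · rw [hradS]
    have h1 : Nat.card W.toAddSubgroup = Nat.card W := rfl
    have h2 : Nat.card ↥(C : Set (SV F n)) = Nat.card C := rfl
    rw [h1, h2, hdim, hdim, hW, hF, ← pow_mul, ← pow_mul, ← pow_add]
    congr 1
    ring
  · rw [hradS]
    exact (min_le_right _ _).trans hpure

/-- Generic method: an `[[n,k,d]]_q` stabilizer code pure to `d'` gives, for each `0 ≤ r < k`,
an `[[n,k-r,r,≥d]]_q` subsystem code pure to `min d d'`; both in the additive and in the
`F_q`-linear settings. -/
theorem stmt5 {p : ℕ} [Fact p.Prime] {F : Type} [Field F] [Fintype F] [CharP F p]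
    {n k d d' : ℕ} :
    (∀ C : AddSubgroup (SV F n), (C : Set (SV F n)) ⊆ sdual p (C : Set (SV F n)) →
      IsSubsystemCode p (Fintype.card F ^ k) 1 d C → PureTo p d' C →
      ∀ r : ℕ, r < k →
        ∃ (Cr : AddSubgroup (SV F n)) (dr : ℕ), d ≤ dr ∧
          IsSubsystemCode p (Fintype.card F ^ (k - r)) (Fintype.card F ^ r) dr Cr ∧
          PureTo p (min d d') Cr) ∧
    (∀ C : Submodule F (SV F n), (C : Set (SV F n)) ⊆ sdual p (C : Set (SV F n)) →
      IsSubsystemCode p (Fintype.card F ^ k) 1 d C.toAddSubgroup →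
      PureTo p d' C.toAddSubgroup →
      ∀ r : ℕ, r < k →
        ∃ (Cr : Submodule F (SV F n)) (dr : ℕ), d ≤ dr ∧
          IsSubsystemCode p (Fintype.card F ^ (k - r)) (Fintype.card F ^ r) dr
            Cr.toAddSubgroup ∧
          PureTo p (min d d') Cr.toAddSubgroup) := by
  constructor
  · intro C hC hcode hpure r hr
    let := ZMod.algebra F p
    have hf : Algebra.trace (ZMod p) F ≠ 0 := Algebra.trace_ne_zero _ _
    obtain ⟨Cr, dr, h⟩ := exists_subsystemCode_of_stabilizerCode (sympForm_isAlt _)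
      (sympForm_nondegenerate hf) (p := p)
      (fun S => by
        ext v
        rw [SetLike.mem_coe, LinearMap.BilinForm.mem_orthogonal_iff]
        exact forall₂_congr fun w _ =>
          (sympForm_isAlt (Algebra.trace (ZMod p) F)).isRefl.eq_iff (x := v) (y := w))
      (AddSubgroup.toZModSubmodule p C) hC hcode hpure hr
    exact ⟨Cr.toAddSubgroup, dr, h⟩
  · intro C hC hcode hpure r hr
    let := ZMod.algebra F p
    have hf : (LinearMap.id : F →ₗ[F] F) ≠ 0 := fun h => one_ne_zero (LinearMap.congr_fun h 1)
    refine exists_subsystemCode_of_stabilizerCode (sympForm_isAlt _)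
      (sympForm_nondegenerate hf) (fun S => ?_) C hC hcode hpure hr
    ext v
    rw [SetLike.mem_coe, LinearMap.BilinForm.mem_orthogonal_iff]
    constructor
    · intro hv w hw
      refine (sympForm_isAlt _).isRefl _ _ ?_
      by_contra h
      obtain ⟨b, hb⟩ : ∃ b, Algebra.trace (ZMod p) F b ≠ 0 := by
        by_contra! h0
        exact Algebra.trace_ne_zero (ZMod p) F (LinearMap.ext h0)
      refine hb ?_
      have := hv ((b / sympForm n LinearMap.id v w) • w) (S.smul_mem _ hw)
      change Algebra.trace (ZMod p) F (sympForm n LinearMap.id v _) = 0 at this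
      rwa [map_smul, smul_eq_mul, div_mul_cancel₀ _ h] at this
    · intro hv w hw
      change Algebra.trace (ZMod p) F (sympForm n LinearMap.id v w) = 0
      rw [(sympForm_isAlt _).isRefl _ _ (hv w hw), map_zero]
end
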